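/- Let F be a field of characteristic 0, K/F a field extension with F algebraically closed in K, δ a derivation on K with Const(δ) = F, and f ∈ K[t;δ] of degree m ≥ 2 an irreducible differential polynomial such that Nuc_r(S_f) is a central division algebra over F. Then S_f is an infinite-dimensional right division algebra over F (every nonzero element of S_f has a left inverse) and S_f has no zero divisors. -/

import Mathlib

open scoped TensorProduct

/-! ## A framework for differential polynomial rings `K[t;δ]` and Petit algebras `S_f`. -/

/-- A derivation on a field `K`: an additive map satisfying the Leibniz rule. -/
structure Der (K : Type) [Field K] where
  toFun : K → K
  map_add' : ∀ a b : K, toFun (a + b) = toFun a + toFun b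
  leibniz' : ∀ a b : K, toFun (a * b) = a * toFun b + toFun a * b

/-- `F` (given as a subfield of `K` via `algebraMap F K`) is precisely the field of
constants `Const(δ) = {a ∈ K | δ(a) = 0}` of the derivation `δ`. -/
def Der.HasConstants {K : Type} [Field K] (δ : Der K) (F : Type) [Field F]
    [Algebra F K] : Prop :=
  ∀ a : K, δ.toFun a = 0 ↔ ∃ c : F, algebraMap F K c = a

/-- The map `V_p(b) = b^p + δ^{p-1}(b)`. -/
def Der.Vp {K : Type} [Field K] (δ : Der K) (p : ℕ) (b : K) : K :=
  b ^ p + δ.toFun^[p - 1] b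

/-- The `e`-fold iterate `V_{p^e}` of `V_p`. -/
def Der.VpIter {K : Type} [Field K] (δ : Der K) (p e : ℕ) : K → K :=
  (δ.Vp p)^[e]

/-- A realization of the differential polynomial ring `R = K[t;δ]`: a ring `R`
together with an embedding `i : K → R` and an element `t` satisfying the
twist relation `t·a = a·t + δ(a)`, such that every element of `R` is *uniquely*
a left `K`-linear combination of the powers `t^n` (witnessed by the coefficient
function `coeff`), and such that `R` admits a right division algorithm. -/
structure DiffPolyRing (K : Type) [Field K] (δ : Der K) (R : Type) [Ring R] where
  i : K →+* R
  t : R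
  coeff : R → (ℕ →₀ K)
  t_mul : ∀ a : K, t * i a = i a * t + i (δ.toFun a)
  repr' : ∀ x : R, x = (coeff x).sum fun n a => i a * t ^ n
  coeff_unique : ∀ (x : R) (c : ℕ →₀ K), x = (c.sum fun n a => i a * t ^ n) → c = coeff x
  rightDiv : ∀ f x : R, f ≠ 0 → ∃! r : R,
    (∃ q : R, x = q * f + r) ∧ (coeff r).support.max < (coeff f).support.max

namespace DiffPolyRing

variable {K : Type} [Field K] {δ : Der K} {R : Type} [Ring R]

/-- The degree of a differential polynomial, with `deg 0 = ⊥`. -/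
def deg (D : DiffPolyRing K δ R) (x : R) : WithBot ℕ := (D.coeff x).support.max

lemma coeff_zero (D : DiffPolyRing K δ R) : D.coeff 0 = 0 :=
  (D.coeff_unique 0 0 (by simp)).symm

lemma deg_zero (D : DiffPolyRing K δ R) : D.deg 0 = ⊥ := by
  simp [deg, D.coeff_zero]

lemma coeff_add (D : DiffPolyRing K δ R) (x y : R) :
    D.coeff (x + y) = D.coeff x + D.coeff y := by
  refine (D.coeff_unique _ _ ?_).symm
  rw [Finsupp.sum_add_index' (by simp) (by intro n a b; rw [map_add, add_mul])]
  conv_lhs => rw [D.repr' x, D.repr' y]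

lemma coeff_neg (D : DiffPolyRing K δ R) (x : R) : D.coeff (-x) = -D.coeff x := by
  have h := D.coeff_add (-x) x
  rw [neg_add_cancel, D.coeff_zero] at h
  exact eq_neg_of_add_eq_zero_left h.symm

lemma deg_neg (D : DiffPolyRing K δ R) (x : R) : D.deg (-x) = D.deg x := by
  simp [deg, D.coeff_neg]

lemma deg_add_lt (D : DiffPolyRing K δ R) {x y : R} {n : WithBot ℕ}
    (hx : D.deg x < n) (hy : D.deg y < n) : D.deg (x + y) < n := by
  have hsub : (D.coeff (x + y)).support ⊆ (D.coeff x).support ∪ (D.coeff y).support := by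
    rw [D.coeff_add]; exact Finsupp.support_add
  calc D.deg (x + y) ≤ ((D.coeff x).support ∪ (D.coeff y).support).max :=
        Finset.max_mono hsub
    _ = max (D.deg x) (D.deg y) := Finset.max_union
    _ < n := max_lt hx hy

lemma coeff_smul (D : DiffPolyRing K δ R) (c : K) (x : R) :
    D.coeff (D.i c * x) = c • D.coeff x := by
  refine (D.coeff_unique _ _ ?_).symm
  rw [Finsupp.sum_smul_index (by simp)]
  conv_lhs => rw [D.repr' x, Finsupp.mul_sum]
  exact Finsupp.sum_congr fun n _ => by rw [← mul_assoc, ← map_mul]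

lemma deg_i_mul_lt (D : DiffPolyRing K δ R) (c : K) {x : R} {n : WithBot ℕ}
    (hx : D.deg x < n) : D.deg (D.i c * x) < n := by
  have hsub : (D.coeff (D.i c * x)).support ⊆ (D.coeff x).support := by
    rw [D.coeff_smul]; exact Finsupp.support_smul
  exact lt_of_le_of_lt (Finset.max_mono hsub) hx

/-- The additive subgroup of `R` consisting of the differential polynomials of
degree `< m`; this is the underlying set of the Petit algebra `S_f` for `deg f = m`. -/
def res (D : DiffPolyRing K δ R) (m : ℕ) : AddSubgroup R where
  carrier := {x | D.deg x < (m : WithBot ℕ)}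
  add_mem' hx hy := D.deg_add_lt hx hy
  zero_mem' := by
    show D.deg 0 < (m : WithBot ℕ)
    rw [D.deg_zero]
    exact bot_lt_iff_ne_bot.2 (by simp)
  neg_mem' {x} hx := by
    show D.deg (-x) < (m : WithBot ℕ)
    rw [D.deg_neg]; exact hx

/-- The underlying set `{g ∈ K[t;δ] | deg g < m}` of the Petit algebra `S_f`
(for `f` of degree `m`), viewed as a subset of `R = K[t;δ]`. -/
def SfSet (D : DiffPolyRing K δ R) (m : ℕ) : Set R := {x | D.deg x < (m : WithBot ℕ)}

/-- The underlying `F`-vector space of the Petit algebra `S_f`, for `f` of degree `m`. -/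
abbrev Rlt (D : DiffPolyRing K δ R) (m : ℕ) : Type := ↥(D.res m)

instance instSMul {F : Type} [Field F] [Algebra F K] (D : DiffPolyRing K δ R) (m : ℕ) :
    SMul F (D.Rlt m) :=
  ⟨fun c x => ⟨D.i (algebraMap F K c) * (x : R), D.deg_i_mul_lt _ x.2⟩⟩

lemma smul_coe {F : Type} [Field F] [Algebra F K] (D : DiffPolyRing K δ R) (m : ℕ)
    (c : F) (x : D.Rlt m) : ((c • x : D.Rlt m) : R) = D.i (algebraMap F K c) * (x : R) := rfl

/-- The `F`-vector space structure of the Petit algebra (where `F ⊆ K` is the field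
of constants): `c • x = i(c)·x`. -/
instance instModule {F : Type} [Field F] [Algebra F K] (D : DiffPolyRing K δ R) (m : ℕ) :
    Module F (D.Rlt m) where
  one_smul x := Subtype.ext <| by rw [smul_coe]; simp
  mul_smul a b x := Subtype.ext <| by rw [smul_coe, smul_coe, smul_coe]; simp [mul_assoc]
  smul_zero a := Subtype.ext <| by rw [smul_coe]; simp
  smul_add a x y := Subtype.ext <| by
    rw [smul_coe]
    push_cast
    rw [smul_coe, smul_coe, mul_add]
  add_smul a b x := Subtype.ext <| by
    push_cast
    rw [smul_coe, smul_coe, smul_coe]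
    simp [add_mul]
  zero_smul x := Subtype.ext <| by rw [smul_coe]; simp

open Classical in
/-- The remainder `mod_r f` of right division by `f`. -/
noncomputable def modr (D : DiffPolyRing K δ R) (f x : R) : R :=
  if h : ∃! r : R, (∃ q : R, x = q * f + r) ∧
      (D.coeff r).support.max < (D.coeff f).support.max then h.choose else 0

/-- The multiplication of the Petit algebra `S_f`: `g ∘ h = g·h mod_r f`. -/
noncomputable def pmul (D : DiffPolyRing K δ R) (f x y : R) : R := D.modr f (x * y)

/-- The left nucleus of the Petit algebra `S_f`, as a subset of `R`. -/
def nucl (D : DiffPolyRing K δ R) (f : R) (m : ℕ) : Set R :=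
  {x ∈ D.SfSet m | ∀ y ∈ D.SfSet m, ∀ z ∈ D.SfSet m,
    D.pmul f (D.pmul f x y) z = D.pmul f x (D.pmul f y z)}

/-- The middle nucleus of the Petit algebra `S_f`, as a subset of `R`. -/
def nucm (D : DiffPolyRing K δ R) (f : R) (m : ℕ) : Set R :=
  {x ∈ D.SfSet m | ∀ y ∈ D.SfSet m, ∀ z ∈ D.SfSet m,
    D.pmul f (D.pmul f y x) z = D.pmul f y (D.pmul f x z)}

/-- The right nucleus of the Petit algebra `S_f`, as a subset of `R`. -/
def nucr (D : DiffPolyRing K δ R) (f : R) (m : ℕ) : Set R :=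
  {x ∈ D.SfSet m | ∀ y ∈ D.SfSet m, ∀ z ∈ D.SfSet m,
    D.pmul f (D.pmul f y z) x = D.pmul f y (D.pmul f z x)}

/-- The nucleus of the Petit algebra `S_f`, as a subset of `R`. -/
def nuc (D : DiffPolyRing K δ R) (f : R) (m : ℕ) : Set R :=
  D.nucl f m ∩ D.nucm f m ∩ D.nucr f m

/-- `f` is irreducible in `K[t;δ]`: it is not a unit and admits no factorization
into two factors of strictly smaller degree. -/
def Irred (D : DiffPolyRing K δ R) (f : R) : Prop :=
  ¬IsUnit f ∧ ¬∃ g h : R, f = g * h ∧ D.deg g < D.deg f ∧ D.deg h < D.deg f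

/-- The Petit algebra `S_f` is a division algebra: it is nonzero, and all left and
right multiplications by nonzero elements are bijective. -/
def IsDivisionPetit (D : DiffPolyRing K δ R) (f : R) (m : ℕ) : Prop :=
  (∃ x ∈ D.SfSet m, x ≠ 0) ∧ ∀ a ∈ D.SfSet m, a ≠ 0 →
    Set.BijOn (fun x => D.pmul f a x) (D.SfSet m) (D.SfSet m) ∧
    Set.BijOn (fun x => D.pmul f x a) (D.SfSet m) (D.SfSet m)

/-- The unital `F`-algebra `B` realizes the right nucleus of the Petit algebra `S_f`:
there is a bijection `B ≃ Nuc_r(S_f)` preserving addition, multiplication and the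
`F`-algebra structure. -/
def RightNucPresents (F : Type) [Field F] [Algebra F K] (D : DiffPolyRing K δ R)
    (f : R) (m : ℕ) (B : Type) [Ring B] [Algebra F B] : Prop :=
  ∃ φ : B ≃ (D.nucr f m),
    (∀ x y : B, ((φ (x + y) : R)) = (φ x : R) + (φ y : R)) ∧
    (∀ x y : B, ((φ (x * y) : R)) = D.pmul f (φ x : R) (φ y : R)) ∧
    (∀ c : F, ((φ (algebraMap F B c) : R)) = D.i (algebraMap F K c))

/-- A subset `S` of an `F`-vector space has dimension `d`: it contains `d` linearly
independent vectors whose span contains `S`. -/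
def SetDim (F : Type) [Field F] {M : Type} [AddCommGroup M] [Module F M]
    (S : Set M) (d : ℕ) : Prop :=
  ∃ s : Finset M, ↑s ⊆ S ∧ s.card = d ∧
    LinearIndependent F (fun x : (s : Set M) => (x : M)) ∧
    S ⊆ (Submodule.span F (s : Set M) : Set M)

/-- `f ∈ K[t;δ]` of degree `m` is an `A`-polynomial (over the field of constants `F`),
via Amitsur's characterization: the right nucleus of `S_f` has dimension `m²` over `F`. -/
def IsAPoly (F : Type) [Field F] [Algebra F K] (D : DiffPolyRing K δ R)
    (f : R) (m : ℕ) : Prop :=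
  SetDim F {x : D.Rlt m | (x : R) ∈ D.nucr f m} (m ^ 2)

/-- `f ∈ R = K[t;δ]` is bounded: there is `f* ≠ 0` such that `Rf* = f*R` is the
largest two-sided ideal of `R` contained in `Rf`. -/
def IsBounded (D : DiffPolyRing K δ R) (f : R) : Prop :=
  ∃ fs : R, fs ≠ 0 ∧
    {x : R | ∃ r, x = r * fs} = {x : R | ∃ r, x = fs * r} ∧
    (∀ x : R, (∃ r, x = r * fs) → ∃ r, x = r * f) ∧
    ∀ J : Set R, (0 : R) ∈ J → (∀ a ∈ J, ∀ b ∈ J, a + b ∈ J) →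
      (∀ r : R, ∀ a ∈ J, r * a ∈ J ∧ a * r ∈ J) →
      (∀ x ∈ J, ∃ r, x = r * f) → ∀ x ∈ J, ∃ r, x = r * fs

/-- `S_f` is a free right module of rank `n` over its right nucleus. -/
def FreeRankOverNucr (D : DiffPolyRing K δ R) (f : R) (m n : ℕ) : Prop :=
  ∃ b : Fin n → R, (∀ j, b j ∈ D.SfSet m) ∧
    ∀ x ∈ D.SfSet m, ∃! c : Fin n → (D.nucr f m),
      x = ∑ j, D.pmul f (b j) ((c j : R))

/-- The Petit algebra `S_f` is unital with unit `1 ∈ K[t;δ]`. -/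
def PetitUnital (D : DiffPolyRing K δ R) (f : R) (m : ℕ) : Prop :=
  (1 : R) ∈ D.SfSet m ∧ ∀ x ∈ D.SfSet m, D.pmul f 1 x = x ∧ D.pmul f x 1 = x

end DiffPolyRing

namespace DiffPolyRing

variable {K : Type} [Field K] {δ : Der K} {R : Type} [Ring R]

lemma deg_lt_iff (D : DiffPolyRing K δ R) (x : R) (n : ℕ) :
    D.deg x < n ↔ D.coeff x ∈ Finsupp.supported K K (Set.Iio n) := by
  rw [Finsupp.mem_supported, deg, Finset.max_eq_sup_withBot]
  refine (Finset.sup_lt_iff (WithBot.bot_lt_coe n)).trans ?_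
  simp [Set.subset_def]

lemma coeff_injective (D : DiffPolyRing K δ R) : Function.Injective D.coeff := by
  intro x y h
  rw [D.repr' x, D.repr' y, h]

lemma ne_zero_of_deg (D : DiffPolyRing K δ R) {x : R} {n : ℕ} (h : D.deg x = n) : x ≠ 0 := by
  rintro rfl
  simp [D.deg_zero] at h

lemma exists_deg_eq (D : DiffPolyRing K δ R) {x : R} (hx : x ≠ 0) :
    ∃ n : ℕ, D.deg x = n := by
  have h : D.coeff x ≠ 0 := fun h => hx (D.coeff_injective (h.trans D.coeff_zero.symm))
  exact Finset.max_of_nonempty (Finsupp.support_nonempty_iff.2 h)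

lemma coeff_i (D : DiffPolyRing K δ R) (c : K) : D.coeff (D.i c) = Finsupp.single 0 c :=
  (D.coeff_unique _ _ (by simp)).symm

lemma coeff_t (D : DiffPolyRing K δ R) : D.coeff D.t = Finsupp.single 1 1 :=
  (D.coeff_unique _ _ (by simp)).symm

lemma i_mem_SfSet (D : DiffPolyRing K δ R) {m : ℕ} (hm : 0 < m) (c : K) :
    D.i c ∈ D.SfSet m := by
  refine (D.deg_lt_iff _ _).2 ?_
  rw [coeff_i]
  exact Finsupp.single_mem_supported K c hm

lemma t_mem_SfSet (D : DiffPolyRing K δ R) {m : ℕ} (hm : 2 ≤ m) : D.t ∈ D.SfSet m := by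
  refine (D.deg_lt_iff _ _).2 ?_
  rw [coeff_t]
  exact Finsupp.single_mem_supported K 1 (Set.mem_Iio.2 hm)

lemma t_commute (D : DiffPolyRing K δ R) (hδ : ∀ a, δ.toFun a = 0) (x : R) :
    Commute D.t x := by
  rw [D.repr' x]
  refine Commute.sum_right _ _ _ fun n _ => Commute.mul_right ?_ (Commute.self_pow _ _)
  have h := D.t_mul (D.coeff x n)
  rwa [hδ, map_zero, add_zero] at h

/-! ### Right division -/

lemma exists_div (D : DiffPolyRing K δ R) {f : R} (hf : f ≠ 0) (x : R) :
    ∃ q r : R, x = q * f + r ∧ D.deg r < D.deg f := by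
  obtain ⟨r, ⟨⟨q, hq⟩, hr⟩, -⟩ := D.rightDiv f x hf
  exact ⟨q, r, hq, hr⟩

lemma modr_spec (D : DiffPolyRing K δ R) {f : R} (hf : f ≠ 0) (x : R) :
    (∃ q : R, x = q * f + D.modr f x) ∧ D.deg (D.modr f x) < D.deg f := by
  have h := D.rightDiv f x hf
  rw [modr, dif_pos h]
  exact h.choose_spec.1

lemma modr_eq (D : DiffPolyRing K δ R) {f : R} (hf : f ≠ 0) {x q r : R}
    (h : x = q * f + r) (hr : D.deg r < D.deg f) : D.modr f x = r :=
  (D.rightDiv f x hf).unique (D.modr_spec hf x) ⟨⟨q, h⟩, hr⟩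

lemma modr_eq_modr (D : DiffPolyRing K δ R) {f : R} (hf : f ≠ 0) {x y q : R}
    (h : x = q * f + y) : D.modr f x = D.modr f y := by
  obtain ⟨⟨p, hp⟩, hlt⟩ := D.modr_spec hf y
  exact D.modr_eq hf (q := q + p) (by rw [add_mul, add_assoc, ← hp, h]) hlt

lemma eq_zero_of_deg_lt (D : DiffPolyRing K δ R) {f q r : R} (h : r = q * f)
    (hr : D.deg r < D.deg f) : r = 0 := by
  have hf : f ≠ 0 := by
    rintro rfl
    simp [D.deg_zero] at hr
  exact (D.modr_eq hf (q := 0) (x := r) (by simp) hr).symm.trans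
    (D.modr_eq hf (q := q) (by simpa using h) (by rw [D.deg_zero]; exact bot_le.trans_lt hr))

lemma exists_eq_span (D : DiffPolyRing K δ R) (J : Submodule R R) (hJ : J ≠ ⊥) :
    ∃ g : R, g ≠ 0 ∧ J = R ∙ g := by
  obtain ⟨x, hx, hx0⟩ := J.exists_mem_ne_zero_of_ne_bot hJ
  obtain ⟨g, ⟨hgJ, hg0⟩, hmin⟩ :=
    (InvImage.wf D.deg wellFounded_lt).has_min {x | x ∈ J ∧ x ≠ 0} ⟨x, hx, hx0⟩
  refine ⟨g, hg0, le_antisymm (fun y hy => ?_) (Submodule.span_singleton_le_iff_mem _ _ |>.2 hgJ)⟩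
  obtain ⟨q, r, rfl, hr⟩ := D.exists_div hg0 y
  have hrJ : r ∈ J := (J.add_mem_iff_right (J.smul_mem q hgJ)).1 hy
  have hr0 : r = 0 := by
    by_contra h
    exact hmin r ⟨hrJ, h⟩ hr
  exact Submodule.mem_span_singleton.2 ⟨q, by simp [hr0]⟩

lemma t_mem_nucr (D : DiffPolyRing K δ R) {f : R} (hf : f ≠ 0) {m : ℕ} (hm : 2 ≤ m)
    (ht : Commute D.t f) : D.t ∈ D.nucr f m := by
  refine ⟨D.t_mem_SfSet hm, fun y _ z _ => ?_⟩
  obtain ⟨⟨p, hp⟩, -⟩ := D.modr_spec hf (y * z)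
  obtain ⟨⟨q, hq⟩, -⟩ := D.modr_spec hf (z * D.t)
  refine D.modr_eq_modr hf (q := y * q - p * D.t) ?_
  have h1 : D.pmul f y z = y * z - p * f := eq_sub_of_add_eq' hp.symm
  have h2 : D.pmul f z D.t = z * D.t - q * f := eq_sub_of_add_eq' hq.symm
  rw [h1, h2, sub_mul, sub_mul, mul_assoc p f, ← ht.eq, mul_sub]
  simp only [mul_assoc]
  abel

/-- Right multiplication by `g`, as a `R`-linear map `R/Rx → R/Rf`, when `x g ∈ Rf`. -/
noncomputable def quotientMulRight (x g f : R)
    (h : x * g ∈ (R ∙ f : Submodule R R)) :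
    (R ⧸ (R ∙ x : Submodule R R)) →ₗ[R] (R ⧸ (R ∙ f : Submodule R R)) :=
  Submodule.mapQ _ _ (LinearMap.toSpanSingleton R R g)
    ((Submodule.span_singleton_le_iff_mem _ _).2 h)

/-! ### Dimensions over `K` -/

section Dimension

variable [Module K R]

/-- The coefficients of a differential polynomial, as a linear equivalence. -/
noncomputable def coeffEquiv (D : DiffPolyRing K δ R)
    (hs : ∀ (c : K) (x : R), c • x = D.i c * x) : R ≃ₗ[K] (ℕ →₀ K) :=
  LinearEquiv.ofBijective
    { toFun := D.coeff
      map_add' := D.coeff_add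
      map_smul' := fun c x => by rw [hs, D.coeff_smul]; rfl }
    ⟨D.coeff_injective, fun c => ⟨_, (D.coeff_unique _ c rfl).symm⟩⟩

/-- The `K`-subspace of differential polynomials of degree less than `n`. -/
noncomputable def degLT (D : DiffPolyRing K δ R)
    (hs : ∀ (c : K) (x : R), c • x = D.i c * x) (n : ℕ) : Submodule K R :=
  (Finsupp.supported K K (Set.Iio n)).comap (D.coeffEquiv hs : R →ₗ[K] (ℕ →₀ K))

lemma mem_degLT (D : DiffPolyRing K δ R)
    (hs : ∀ (c : K) (x : R), c • x = D.i c * x) {n : ℕ} {x : R} :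
    x ∈ D.degLT hs n ↔ D.deg x < n :=
  (D.deg_lt_iff x n).symm

/-- Differential polynomials of degree less than `n` are determined by `n` coefficients. -/
noncomputable def degLTEquiv (D : DiffPolyRing K δ R)
    (hs : ∀ (c : K) (x : R), c • x = D.i c * x) (n : ℕ) :
    D.degLT hs n ≃ₗ[K] (Set.Iio n →₀ K) :=
  ((D.coeffEquiv hs).ofSubmodule' _).trans (Finsupp.supportedEquivFinsupp _)

lemma not_finite (D : DiffPolyRing K δ R)
    (hs : ∀ (c : K) (x : R), c • x = D.i c * x) : ¬Module.Finite K R := by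
  intro h
  have : Module.Finite K (ℕ →₀ K) := Module.Finite.equiv (D.coeffEquiv hs)
  exact not_finite_iff_infinite.2 inferInstance (Module.Finite.finite_basis
    (Finsupp.basisSingleOne (R := K) (ι := ℕ)))

variable [IsScalarTower K R R]

/-- Remainders of right division by `f` represent the cosets of the left ideal `Rf`. -/
noncomputable def degLTEquivQuotient (D : DiffPolyRing K δ R)
    (hs : ∀ (c : K) (x : R), c • x = D.i c * x) {f : R} {n : ℕ} (hf : D.deg f = n) :
    D.degLT hs n ≃ₗ[K] R ⧸ (R ∙ f : Submodule R R) :=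
  LinearEquiv.ofBijective
    (((R ∙ f : Submodule R R).mkQ.restrictScalars K).comp (D.degLT hs n).subtype) <| by
    constructor
    · rw [injective_iff_map_eq_zero]
      rintro ⟨x, hx⟩ h
      obtain ⟨q, hq⟩ := Submodule.mem_span_singleton.1 ((Submodule.Quotient.mk_eq_zero _).1 h)
      exact Subtype.ext (D.eq_zero_of_deg_lt hq.symm (hf ▸ (D.mem_degLT hs).1 hx))
    · intro y
      obtain ⟨y, rfl⟩ := Submodule.mkQ_surjective _ y
      obtain ⟨q, r, rfl, hr⟩ := D.exists_div (D.ne_zero_of_deg hf) y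
      refine ⟨⟨r, (D.mem_degLT hs).2 (hf ▸ hr)⟩, ?_⟩
      refine (Submodule.Quotient.eq _).2 (Submodule.mem_span_singleton.2 ⟨-q, ?_⟩)
      simp

lemma finite_quotient (D : DiffPolyRing K δ R)
    (hs : ∀ (c : K) (x : R), c • x = D.i c * x) {f : R} (hf : f ≠ 0) :
    Module.Finite K (R ⧸ (R ∙ f : Submodule R R)) := by
  obtain ⟨n, hn⟩ := D.exists_deg_eq hf
  exact Module.Finite.equiv ((D.degLTEquiv hs n).symm.trans (D.degLTEquivQuotient hs hn))

lemma finrank_quotient (D : DiffPolyRing K δ R)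
    (hs : ∀ (c : K) (x : R), c • x = D.i c * x) {f : R} {n : ℕ} (hf : D.deg f = n) :
    Module.finrank K (R ⧸ (R ∙ f : Submodule R R)) = n := by
  rw [← ((D.degLTEquiv hs n).symm.trans (D.degLTEquivQuotient hs hf)).finrank_eq]
  simp

lemma mul_ne_zero (D : DiffPolyRing K δ R)
    (hs : ∀ (c : K) (x : R), c • x = D.i c * x) {x g : R} (hx : x ≠ 0) (hg : g ≠ 0) :
    x * g ≠ 0 := by
  intro h
  have := D.finite_quotient hs hx
  have := D.finite_quotient hs hg
  let φ : (R ⧸ (R ∙ x : Submodule R R)) →ₗ[R] R :=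
    Submodule.liftQ _ (LinearMap.toSpanSingleton R R g)
      ((Submodule.span_singleton_le_iff_mem _ _).2 h)
  have hφ : LinearMap.range φ = R ∙ g := by
    rw [Submodule.range_liftQ, LinearMap.range_toSpanSingleton]
  have : Module.Finite K ((R ∙ g : Submodule R R).restrictScalars K) := by
    rw [← hφ]
    exact Module.Finite.range (φ.restrictScalars K)
  have : Module.Finite K (R ⧸ ((R ∙ g : Submodule R R).restrictScalars K)) :=
    Module.Finite.equiv (Submodule.Quotient.restrictScalarsEquiv K (R ∙ g : Submodule R R)).symm
  exact D.not_finite hs (Module.Finite.of_submodule_quotient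
    ((R ∙ g : Submodule R R).restrictScalars K))

lemma isSimpleModule_quotient (D : DiffPolyRing K δ R)
    (hs : ∀ (c : K) (x : R), c • x = D.i c * x) {f : R} (hf : f ≠ 0) (hirr : D.Irred f)
    (hpos : 0 < D.deg f) : IsSimpleModule R (R ⧸ (R ∙ f : Submodule R R)) := by
  obtain ⟨m, hm⟩ := D.exists_deg_eq hf
  have hfin := D.finite_quotient hs hf
  have hrank := D.finrank_quotient hs hm
  rw [isSimpleModule_iff_isCoatom]
  refine ⟨fun h => ?_, fun J hJ => ?_⟩
  · rw [h] at hrank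
    have : Module.finrank K (R ⧸ (⊤ : Submodule R R)) = 0 := Module.finrank_zero_of_subsingleton
    rw [hm, ← hrank, this] at hpos
    exact lt_irrefl _ hpos
  · obtain ⟨g, hg, rfl⟩ := D.exists_eq_span J (ne_bot_of_gt hJ)
    have hfin' := D.finite_quotient hs hg
    obtain ⟨q, hq⟩ := Submodule.mem_span_singleton.1 (hJ.le (Submodule.mem_span_singleton_self f))
    rw [smul_eq_mul] at hq
    have hq0 : q ≠ 0 := by
      rintro rfl
      exact hf (by rw [← hq, zero_mul])
    have hfin'' := D.finite_quotient hs hq0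
    by_cases hdq : D.deg q < D.deg f
    · exfalso
      have hdg : ¬D.deg g < D.deg f := fun h => hirr.2 ⟨q, g, hq.symm, hdq, h⟩
      obtain ⟨n, hn⟩ := D.exists_deg_eq hg
      have hmn : m ≤ n := by simpa [hm, hn] using hdg
      have hsurj : Function.Surjective
          (Submodule.factor hJ.le : _ →ₗ[R] R ⧸ (R ∙ g : Submodule R R)) :=
        Submodule.factor_surjective hJ.le
      have hle := LinearMap.finrank_le_finrank_of_surjective
        (f := (Submodule.factor hJ.le).restrictScalars K) hsurj
      have hinj := (LinearMap.injective_iff_surjective_of_finrank_eq_finrank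
        (f := (Submodule.factor hJ.le).restrictScalars K)
        (le_antisymm (by rw [hrank, D.finrank_quotient hs hn]; exact hmn) hle)).2 hsurj
      refine hJ.not_ge fun y hy => ?_
      refine (Submodule.Quotient.mk_eq_zero _).1 (hinj ?_)
      rw [map_zero]
      exact (Submodule.Quotient.mk_eq_zero _).2 hy
    · obtain ⟨n, hn⟩ := D.exists_deg_eq hq0
      have hmn : m ≤ n := by simpa [hm, hn] using hdq
      let ψ := quotientMulRight q g f (hq ▸ Submodule.mem_span_singleton_self _)
      have hinj : Function.Injective (ψ.restrictScalars K) := by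
        rw [injective_iff_map_eq_zero]
        intro z
        obtain ⟨z, rfl⟩ := Submodule.mkQ_surjective _ z
        intro hz
        obtain ⟨y, hy⟩ := Submodule.mem_span_singleton.1 ((Submodule.Quotient.mk_eq_zero _).1 hz)
        refine (Submodule.Quotient.mk_eq_zero _).2 (Submodule.mem_span_singleton.2 ⟨y, ?_⟩)
        have h0 : (y * q - z) * g = 0 := by
          rw [sub_mul, mul_assoc, hq, sub_eq_zero]
          exact hy
        by_contra hne
        exact D.mul_ne_zero hs (sub_ne_zero.2 hne) hg h0
      have hle := LinearMap.finrank_le_finrank_of_injective hinj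
      have hsurj := (LinearMap.injective_iff_surjective_of_finrank_eq_finrank
        (f := ψ.restrictScalars K)
        (le_antisymm hle (by rw [hrank, D.finrank_quotient hs hn]; exact hmn))).1 hinj
      obtain ⟨z, hz⟩ := hsurj (Submodule.Quotient.mk 1)
      obtain ⟨z, rfl⟩ := Submodule.mkQ_surjective _ z
      have h1 : z * g - 1 ∈ (R ∙ f : Submodule R R) := (Submodule.Quotient.eq _).1 hz
      have h2 : (1 : R) ∈ (R ∙ g : Submodule R R) := by
        have := Submodule.sub_mem _ (Submodule.mem_span_singleton.2 ⟨z, rfl⟩) (hJ.le h1)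
        simpa using this
      exact (Ideal.eq_top_iff_one (R ∙ g : Submodule R R)).2 h2

lemma eq_zero_or_eq_zero_of_mul_mem (D : DiffPolyRing K δ R)
    (hs : ∀ (c : K) (x : R), c • x = D.i c * x) {f : R} (hf : f ≠ 0) (hirr : D.Irred f)
    (hpos : 0 < D.deg f) {a b : R} (ha : D.deg a < D.deg f) (hb : D.deg b < D.deg f)
    (hab : a * b ∈ (R ∙ f : Submodule R R)) : a = 0 ∨ b = 0 := by
  by_contra! h
  obtain ⟨m, hm⟩ := D.exists_deg_eq hf
  obtain ⟨n, hn⟩ := D.exists_deg_eq h.1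
  have hsimple := D.isSimpleModule_quotient hs hf hirr hpos
  have := D.finite_quotient hs h.1
  let ψ := quotientMulRight a b f hab
  have hψ : ψ ≠ 0 := by
    intro h0
    have h1 : ψ (Submodule.Quotient.mk 1) = 0 := by rw [h0, LinearMap.zero_apply]
    obtain ⟨q, hq⟩ := Submodule.mem_span_singleton.1 ((Submodule.Quotient.mk_eq_zero _).1 h1)
    exact h.2 (D.eq_zero_of_deg_lt (by simpa using hq.symm) hb)
  have hle := LinearMap.finrank_le_finrank_of_surjective (f := ψ.restrictScalars K)
    (LinearMap.surjective_of_ne_zero (f := ψ) hψ)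
  rw [D.finrank_quotient hs hn, D.finrank_quotient hs hm] at hle
  rw [hm, hn] at ha
  exact absurd (WithBot.coe_lt_coe.1 ha) (not_lt.2 hle)

lemma exists_pmul_eq_one (D : DiffPolyRing K δ R)
    (hs : ∀ (c : K) (x : R), c • x = D.i c * x) {f : R} {m : ℕ} (hm : D.deg f = m)
    (hirr : D.Irred f) (hpos : 0 < m) {h : R} (hh : D.deg h < m) (h0 : h ≠ 0) :
    ∃ z ∈ D.SfSet m, D.pmul f z h = 1 := by
  have hf := D.ne_zero_of_deg hm
  have := D.finite_quotient hs hf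
  have : Module.Finite K (D.degLT hs m) := Module.Finite.equiv (D.degLTEquivQuotient hs hm).symm
  let ψ : D.degLT hs m →ₗ[K] R ⧸ (R ∙ f : Submodule R R) :=
    (((R ∙ f : Submodule R R).mkQ.comp (LinearMap.toSpanSingleton R R h)).restrictScalars K).comp
      (D.degLT hs m).subtype
  have hinj : Function.Injective ψ := by
    rw [injective_iff_map_eq_zero]
    rintro ⟨x, hx⟩ hz
    have hx' := (D.mem_degLT hs).1 hx
    refine Subtype.ext ((D.eq_zero_or_eq_zero_of_mul_mem hs hf hirr ?_ (hm ▸ hx') (hm ▸ hh)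
      ((Submodule.Quotient.mk_eq_zero _).1 hz)).resolve_right h0)
    rw [hm]
    exact WithBot.coe_lt_coe.2 hpos
  obtain ⟨⟨z, hz⟩, hz1⟩ := (LinearMap.injective_iff_surjective_of_finrank_eq_finrank
    (D.degLTEquivQuotient hs hm).finrank_eq).1 hinj (Submodule.Quotient.mk 1)
  obtain ⟨q, hq⟩ := Submodule.mem_span_singleton.1 ((Submodule.Quotient.eq _).1 hz1)
  refine ⟨z, (D.mem_degLT hs).1 hz, D.modr_eq hf (q := q) ?_ ?_⟩
  · exact (sub_eq_iff_eq_add.1 hq.symm)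
  · rw [hm, ← map_one D.i]
    exact D.i_mem_SfSet hpos 1

end Dimension

lemma exists_ne_zero_of_isCentral {F : Type} [Field F] [Algebra F K] (D : DiffPolyRing K δ R)
    {f : R} (hf : f ≠ 0) {m : ℕ} (hm : 2 ≤ m) {B : Type} [Ring B] [Algebra F B]
    (hcentral : Algebra.IsCentral F B) (hpres : D.RightNucPresents F f m B) :
    ∃ a, δ.toFun a ≠ 0 := by
  by_contra! hδ
  obtain ⟨φ, -, hmul, halg⟩ := hpres
  obtain ⟨b, hb⟩ := φ.surjective ⟨D.t, D.t_mem_nucr hf hm (D.t_commute hδ f)⟩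
  have hbt : (φ b : R) = D.t := by rw [hb]
  have hbc : b ∈ Subalgebra.center F B := by
    refine Subalgebra.mem_center_iff.2 fun x => φ.injective (Subtype.ext ?_)
    rw [hmul, hmul, hbt, pmul, pmul, (D.t_commute hδ _).eq]
  obtain ⟨c, rfl⟩ := Algebra.mem_bot.1 (hcentral.out hbc)
  have h := congrArg D.coeff (hbt.symm.trans (halg c))
  rw [coeff_t, coeff_i] at h
  simpa using DFunLike.congr_fun h 1

/-- The inclusion of `K` into the Petit algebra as the constant polynomials. -/
def constLinearMap (F : Type) [Field F] [Algebra F K] (D : DiffPolyRing K δ R) {m : ℕ}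
    (hm : 0 < m) : K →ₗ[F] D.Rlt m where
  toFun c := ⟨D.i c, D.i_mem_SfSet hm c⟩
  map_add' a b := Subtype.ext (map_add D.i a b)
  map_smul' c a := Subtype.ext <|
    (congrArg D.i (Algebra.smul_def c a)).trans (map_mul D.i _ _)

lemma constLinearMap_injective (F : Type) [Field F] [Algebra F K] (D : DiffPolyRing K δ R)
    {m : ℕ} (hm : 0 < m) : Function.Injective (D.constLinearMap F hm) := by
  intro a b h
  have h' := congrArg (fun x : D.Rlt m => D.coeff x) h
  exact Finsupp.single_injective 0 ((D.coeff_i a).symm.trans (h'.trans (D.coeff_i b)))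

end DiffPolyRing

/-- Char. zero, `F` algebraically closed in `K`, `δ` a derivation on `K`
with constants `F`, and `f ∈ K[t;δ]` irreducible of degree `m ≥ 2` such that the right
nucleus of `S_f` is a central division algebra over `F`.  Then `S_f` is an
infinite-dimensional right division algebra over `F` (every nonzero element has a left
inverse) and `S_f` has no zero divisors. -/
theorem statement_2 (F K : Type) [Field F] [CharZero F] [Field K] [Algebra F K]
    (halgclosed : ∀ x : K, IsAlgebraic F x → ∃ c : F, algebraMap F K c = x)
    (δ : Der K) (hconst : δ.HasConstants F)
    (R : Type) [Ring R] (D : DiffPolyRing K δ R) (f : R) (m : ℕ) (hm : 2 ≤ m)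
    (hdeg : D.deg f = (m : WithBot ℕ)) (hirr : D.Irred f)
    (B : Type) [DivisionRing B] [Algebra F B] (hcentral : Algebra.IsCentral F B)
    (hpres : D.RightNucPresents F f m B) :
    ¬FiniteDimensional F (D.Rlt m) ∧
    (∀ h ∈ D.SfSet m, h ≠ 0 → ∃ z ∈ D.SfSet m, D.pmul f z h = 1) ∧
    (∀ a ∈ D.SfSet m, ∀ b ∈ D.SfSet m, D.pmul f a b = 0 → a = 0 ∨ b = 0) := by
  have hf := D.ne_zero_of_deg hdeg
  have hm0 : 0 < m := by omega
  have hpos : 0 < D.deg f := hdeg ▸ WithBot.coe_lt_coe.2 hm0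
  let : Module K R := Module.compHom R D.i
  have hs : ∀ (c : K) (x : R), c • x = D.i c * x := fun _ _ => rfl
  have : IsScalarTower K R R := ⟨fun c x y => by rw [hs, hs, smul_eq_mul, smul_eq_mul, mul_assoc]⟩
  refine ⟨fun hfin => ?_, fun h hh h0 => D.exists_pmul_eq_one hs hdeg hirr hm0 hh h0,
    fun a ha b hb hab => ?_⟩
  · have : FiniteDimensional F K := Module.Finite.of_injective (D.constLinearMap F hm0)
      (D.constLinearMap_injective F hm0)
    obtain ⟨a, ha⟩ := D.exists_ne_zero_of_isCentral hf hm hcentral hpres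
    exact ha ((hconst a).2 (halgclosed a (Algebra.IsAlgebraic.isAlgebraic a)))
  · obtain ⟨⟨q, hq⟩, -⟩ := D.modr_spec hf (a * b)
    refine D.eq_zero_or_eq_zero_of_mul_mem hs hf hirr hpos (hdeg ▸ ha) (hdeg ▸ hb)
      (Submodule.mem_span_singleton.2 ⟨q, ?_⟩)
    rw [smul_eq_mul, hq, show D.modr f (a * b) = 0 from hab, add_zero]
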